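/- Let l ≥ 2 and 0 < k_1 < k_2 < … < k_{l−1} be fixed integers. Then almost surely, as x → ∞, Π_{X,X+k_1,…,X+k_{l−1}}(x) ~ x/(log x)^l; that is, for ℙ-almost every realization α of the Hawkins random sieve, the number of m ≤ x with {m, m+k_1, …, m+k_{l−1}} ⊆ α is asymptotic to x/(log x)^l. -/

import Mathlib

open MeasureTheory Filter Finset Asymptotics
open scoped Classical

/-- `y_m(α) = ∏_{j ∈ α, j < m} (1 - 1/j)` (empty product = 1). -/
noncomputable def hawkinsY (A : Set ℕ) (m : ℕ) : ℝ :=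
  ∏ j ∈ Finset.range m, if j ∈ A then 1 - 1 / (j : ℝ) else 1

/-- The σ-algebra generated by the events `{j ∈ α}` for `2 ≤ j < m`. -/
def sieveSigma {Ω : Type*} (α : Ω → Set ℕ) (m : ℕ) : MeasurableSpace Ω :=
  MeasurableSpace.generateFrom {s | ∃ j : ℕ, 2 ≤ j ∧ j < m ∧ s = {ω | j ∈ α ω}}

/-- Wunderlich's model of the Hawkins random sieve: a probability space `(Ω, μ)` with a
random subset `α` of `{2,3,4,…}` such that `μ(2 ∈ α) = 1` and, for every `m ≥ 2`, the
conditional probability of `{m ∈ α}` given the σ-algebra generated by the events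
`{j ∈ α}`, `2 ≤ j < m`, equals `y_m(α)`. -/
structure IsHawkinsSieve {Ω : Type*} [MeasurableSpace Ω] (μ : Measure Ω)
    (α : Ω → Set ℕ) : Prop where
  isProb : IsProbabilityMeasure μ
  meas : ∀ n : ℕ, MeasurableSet {ω | n ∈ α ω}
  mem_ge_two : ∀ ω, ∀ n ∈ α ω, 2 ≤ n
  two_mem : μ {ω | 2 ∈ α ω} = 1
  condExp_mem : ∀ m : ℕ, 2 ≤ m →
    μ[Set.indicator {ω | m ∈ α ω} (fun _ => (1 : ℝ)) | sieveSigma α m]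
      =ᵐ[μ] fun ω => hawkinsY (α ω) m

/-- `M_k = 1 + ∑_{j=1}^{k-2} 1/j` (so `M_2 = 1`). -/
noncomputable def Mharm (k : ℕ) : ℝ := 1 + ∑ j ∈ Finset.Icc 1 (k - 2), 1 / (j : ℝ)

/-- `Π_{X,X+k_1,…,X+k_{l-1}}(x; α)`: the number of `m ≤ x` with
`{m, m+k_1, …, m+k_{l-1}} ⊆ α`. -/
noncomputable def piTuple (A : Set ℕ) (l : ℕ) (k : ℕ → ℕ) (x : ℕ) : ℕ :=
  ((Finset.range (x + 1)).filter
    fun m => m ∈ A ∧ ∀ j : ℕ, 1 ≤ j → j ≤ l - 1 → m + k j ∈ A).card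

/-- The indicator function of `A`, as a real-valued sequence. -/
noncomputable def memInd (A : Set ℕ) (n : ℕ) : ℝ := if n ∈ A then 1 else 0

lemma memInd_nonneg (A : Set ℕ) (n : ℕ) : 0 ≤ memInd A n := by
  unfold memInd; split_ifs <;> norm_num

lemma memInd_le_one (A : Set ℕ) (n : ℕ) : memInd A n ≤ 1 := by
  unfold memInd; split_ifs <;> norm_num

lemma memInd_mul_self (A : Set ℕ) (n : ℕ) : memInd A n * memInd A n = memInd A n := by
  unfold memInd; split_ifs <;> norm_num

section SieveProduct

variable {A : Set ℕ}

lemma hawkinsY_succ (A : Set ℕ) (n : ℕ) :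
    hawkinsY A (n + 1) = hawkinsY A n * (1 - memInd A n / n) := by
  unfold hawkinsY memInd
  rw [Finset.prod_range_succ]
  split_ifs <;> simp

lemma hawkinsY_pos (hA : ∀ n ∈ A, 2 ≤ n) (n : ℕ) : 0 < hawkinsY A n := by
  refine Finset.prod_pos fun j _ => ?_
  split_ifs with hj
  · have h2 : (2 : ℝ) ≤ j := by exact_mod_cast hA j hj
    rw [sub_pos, div_lt_one (by linarith)]
    linarith
  · norm_num

lemma hawkinsY_antitone (hA : ∀ n ∈ A, 2 ≤ n) : Antitone (hawkinsY A) := by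
  refine antitone_nat_of_succ_le fun n => ?_
  rw [hawkinsY_succ]
  refine mul_le_of_le_one_right (hawkinsY_pos hA n).le ?_
  have := div_nonneg (memInd_nonneg A n) (Nat.cast_nonneg (α := ℝ) n)
  linarith

lemma hawkinsY_zero (A : Set ℕ) : hawkinsY A 0 = 1 := by simp [hawkinsY]

lemma hawkinsY_le_one (hA : ∀ n ∈ A, 2 ≤ n) (n : ℕ) : hawkinsY A n ≤ 1 :=
  (hawkinsY_antitone hA (Nat.zero_le n)).trans_eq (hawkinsY_zero A)

lemma hawkinsY_two (hA : ∀ n ∈ A, 2 ≤ n) : hawkinsY A 2 = 1 := by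
  have h0 : 0 ∉ A := fun h => by have := hA 0 h; omega
  have h1 : 1 ∉ A := fun h => by have := hA 1 h; omega
  simp [hawkinsY, Finset.prod_range_succ, h0, h1]

lemma one_half_pow_le_hawkinsY (hA : ∀ n ∈ A, 2 ≤ n) (n : ℕ) :
    (1 / 2 : ℝ) ^ n ≤ hawkinsY A n := by
  have : (1 / 2 : ℝ) ^ n = ∏ _j ∈ Finset.range n, (1 / 2 : ℝ) := by simp
  rw [this]
  refine Finset.prod_le_prod (fun _ _ => by norm_num) fun j _ => ?_
  split_ifs with hj
  · have h2 : (2 : ℝ) ≤ j := by exact_mod_cast hA j hj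
    have := one_div_le_one_div_of_le (by norm_num) h2
    linarith
  · norm_num

lemma hawkinsY_sub_le (hA : ∀ n ∈ A, 2 ≤ n) {m : ℕ} (hm : 1 ≤ m) (d : ℕ) :
    hawkinsY A m - hawkinsY A (m + d) ≤ d / m := by
  have hm0 : (0 : ℝ) < m := by exact_mod_cast hm
  induction d with
  | zero => simp
  | succ d ih =>
    have h1 : hawkinsY A (m + d) * (memInd A (m + d) / ((m + d : ℕ) : ℝ)) ≤ 1 * (1 / m) := by
      refine mul_le_mul (hawkinsY_le_one hA _) ?_
        (div_nonneg (memInd_nonneg _ _) (Nat.cast_nonneg _)) zero_le_one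
      refine div_le_div₀ zero_le_one (memInd_le_one _ _) hm0 ?_
      exact_mod_cast Nat.le_add_right m d
    have h2 := hawkinsY_succ A (m + d)
    have h3 : ((d + 1 : ℕ) : ℝ) / m = d / m + 1 / m := by push_cast; ring
    rw [← add_assoc, h2, h3]
    linarith

/-- The martingale representation of the reciprocal of the sieve product. -/
lemma inv_hawkinsY_eq (hA : ∀ n ∈ A, 2 ≤ n) (m : ℕ) :
    (hawkinsY A (m + 2))⁻¹ = 1 + ∑ j ∈ range m, 1 / ((j : ℝ) + 1)
      + ∑ j ∈ range m, (hawkinsY A (j + 2))⁻¹ / (j + 1)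
        * (memInd A (j + 2) - hawkinsY A (j + 2)) := by
  induction m with
  | zero => simp [hawkinsY_two hA]
  | succ m ih =>
    rw [Finset.sum_range_succ, Finset.sum_range_succ]
    have key : (hawkinsY A (m + 1 + 2))⁻¹ = (hawkinsY A (m + 2))⁻¹ + 1 / ((m : ℝ) + 1)
        + (hawkinsY A (m + 2))⁻¹ / (m + 1) * (memInd A (m + 2) - hawkinsY A (m + 2)) := by
      rw [show m + 1 + 2 = (m + 2) + 1 by ring, hawkinsY_succ]
      have hy := (hawkinsY_pos hA (m + 2)).ne'
      have hm : (m : ℝ) + 1 ≠ 0 := by positivity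
      have hm2 : (m : ℝ) + 2 ≠ 0 := by positivity
      have hm3 : (1 : ℝ) + m ≠ 0 := by positivity
      unfold memInd
      push_cast
      split_ifs
      · rw [show 1 - 1 / ((m : ℝ) + 2) = (m + 1) / (m + 2) by field_simp; ring]
        field_simp
        ring
      · field_simp
        ring
    rw [key, ih]
    ring

end SieveProduct

section SquareIntegrable

variable {Ω : Type*} {mΩ : MeasurableSpace Ω}

lemma ae_tendsto_zero_of_summable_integral_sq {μ : Measure Ω} {f : ℕ → Ω → ℝ}
    (hf : ∀ n, AEMeasurable (f n) μ) (hint : ∀ n, Integrable (fun ω => f n ω ^ 2) μ)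
    (hsum : Summable fun n => ∫ ω, f n ω ^ 2 ∂μ) :
    ∀ᵐ ω ∂μ, Tendsto (fun n => f n ω) atTop (nhds 0) := by
  have hmeas : ∀ n, AEMeasurable (fun ω => ENNReal.ofReal (f n ω ^ 2)) μ := fun n =>
    ((hf n).pow_const 2).ennreal_ofReal
  have hfin : ∫⁻ ω, ∑' n, ENNReal.ofReal (f n ω ^ 2) ∂μ ≠ ⊤ := by
    rw [lintegral_tsum hmeas]
    simp_rw [← fun n => ofReal_integral_eq_lintegral_ofReal (hint n)
      (Eventually.of_forall fun ω => sq_nonneg (f n ω))]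
    exact hsum.tsum_ofReal_ne_top
  filter_upwards [ae_lt_top' (AEMeasurable.tsum hmeas) hfin] with ω hω
  have h1 := ENNReal.tendsto_atTop_zero_of_tsum_ne_top hω.ne
  have h2 := (ENNReal.tendsto_toReal ENNReal.zero_ne_top).comp h1
  have h3 : Tendsto (fun n => f n ω ^ 2) atTop (nhds 0) := by
    refine h2.congr fun n => ?_
    simp [ENNReal.toReal_ofReal (sq_nonneg _)]
  have h4 := h3.sqrt
  simp only [Real.sqrt_sq_eq_abs, Real.sqrt_zero] at h4
  exact (tendsto_zero_iff_abs_tendsto_zero _).2 h4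

/-- Bounded functions measurable with respect to the σ-algebra `m`. -/
def BddMeas (m : MeasurableSpace Ω) (f : Ω → ℝ) : Prop :=
  Measurable[m] f ∧ ∃ C : ℝ, ∀ ω, |f ω| ≤ C

namespace BddMeas

lemma integrable {μ : Measure Ω} {f : Ω → ℝ} [IsFiniteMeasure μ] (hf : BddMeas mΩ f) :
    Integrable f μ := by
  obtain ⟨C, hC⟩ := hf.2
  exact Integrable.of_bound hf.1.aestronglyMeasurable C (Eventually.of_forall hC)

variable {m m' : MeasurableSpace Ω} {f g : Ω → ℝ}

lemma mono (hm : m ≤ m') (hf : BddMeas m f) : BddMeas m' f :=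
  ⟨hf.1.mono hm le_rfl, hf.2⟩

lemma const (c : ℝ) : BddMeas m fun _ => c :=
  ⟨measurable_const, |c|, fun _ => le_rfl⟩

lemma add (hf : BddMeas m f) (hg : BddMeas m g) : BddMeas m fun ω => f ω + g ω := by
  obtain ⟨C, hC⟩ := hf.2
  obtain ⟨D, hD⟩ := hg.2
  exact ⟨hf.1.add hg.1, C + D, fun ω => (abs_add_le _ _).trans (add_le_add (hC ω) (hD ω))⟩

lemma sub (hf : BddMeas m f) (hg : BddMeas m g) : BddMeas m fun ω => f ω - g ω := by
  obtain ⟨C, hC⟩ := hf.2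
  obtain ⟨D, hD⟩ := hg.2
  exact ⟨hf.1.sub hg.1, C + D, fun ω => (abs_sub _ _).trans (add_le_add (hC ω) (hD ω))⟩

lemma mul (hf : BddMeas m f) (hg : BddMeas m g) : BddMeas m fun ω => f ω * g ω := by
  obtain ⟨C, hC⟩ := hf.2
  obtain ⟨D, hD⟩ := hg.2
  refine ⟨hf.1.mul hg.1, C * D, fun ω => ?_⟩
  rw [abs_mul]
  exact mul_le_mul (hC ω) (hD ω) (abs_nonneg _) ((abs_nonneg _).trans (hC ω))

lemma pow (hf : BddMeas m f) (n : ℕ) : BddMeas m fun ω => f ω ^ n := by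
  induction n with
  | zero => simpa using const 1
  | succ n ih => simpa only [pow_succ] using ih.mul hf

lemma sum {ι : Type*} (s : Finset ι) {f : ι → Ω → ℝ} (hf : ∀ i ∈ s, BddMeas m (f i)) :
    BddMeas m fun ω => ∑ i ∈ s, f i ω := by
  induction s using Finset.induction_on with
  | empty => simpa using const 0
  | insert i s hi ih =>
    simp only [Finset.sum_insert hi]
    exact (hf i (Finset.mem_insert_self i s)).add
      (ih fun j hj => hf j (Finset.mem_insert_of_mem hj))

lemma prod {ι : Type*} (s : Finset ι) {f : ι → Ω → ℝ} (hf : ∀ i ∈ s, BddMeas m (f i)) :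
    BddMeas m fun ω => ∏ i ∈ s, f i ω := by
  induction s using Finset.induction_on with
  | empty => simpa using const 1
  | insert i s hi ih =>
    simp only [Finset.prod_insert hi]
    exact (hf i (Finset.mem_insert_self i s)).mul
      (ih fun j hj => hf j (Finset.mem_insert_of_mem hj))

end BddMeas

end SquareIntegrable

namespace IsHawkinsSieve

variable {Ω : Type*} {mΩ : MeasurableSpace Ω} {μ : Measure Ω} {α : Ω → Set ℕ}

lemma sieveSigma_mono (α : Ω → Set ℕ) : Monotone (sieveSigma α) := by
  intro m n hmn
  refine MeasurableSpace.generateFrom_mono ?_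
  rintro s ⟨j, h2, hj, rfl⟩
  exact ⟨j, h2, hj.trans_le hmn, rfl⟩

lemma sieveSigma_le (h : IsHawkinsSieve μ α) (m : ℕ) : sieveSigma α m ≤ mΩ := by
  refine MeasurableSpace.generateFrom_le ?_
  rintro s ⟨j, -, -, rfl⟩
  exact h.meas j

lemma bddMeas_memInd (h : IsHawkinsSieve μ α) {j m : ℕ} (hj : j < m) :
    BddMeas (sieveSigma α m) fun ω => memInd (α ω) j := by
  refine ⟨?_, 1, fun ω => ?_⟩
  · have hs : MeasurableSet[sieveSigma α m] {ω | j ∈ α ω} := by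
      by_cases h2 : 2 ≤ j
      · exact MeasurableSpace.measurableSet_generateFrom ⟨j, h2, hj, rfl⟩
      · have : {ω | j ∈ α ω} = ∅ := by
          ext ω
          simpa using fun hω => h2 (h.mem_ge_two ω j hω)
        rw [this]
        exact @MeasurableSet.empty _ (sieveSigma α m)
    exact Measurable.ite hs measurable_const measurable_const
  · rw [abs_of_nonneg (memInd_nonneg _ _)]
    exact memInd_le_one _ _

lemma bddMeas_hawkinsY (h : IsHawkinsSieve μ α) (m : ℕ) :
    BddMeas (sieveSigma α m) fun ω => hawkinsY (α ω) m := by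
  have : (fun ω => hawkinsY (α ω) m)
      = fun ω => ∏ j ∈ range m, (1 - memInd (α ω) j * (1 / (j : ℝ))) := by
    ext ω
    unfold hawkinsY memInd
    refine Finset.prod_congr rfl fun j _ => ?_
    split_ifs <;> simp
  rw [this]
  refine BddMeas.prod _ fun j hj => ?_
  exact (BddMeas.const 1).sub
    ((h.bddMeas_memInd (Finset.mem_range.1 hj)).mul (BddMeas.const _))

lemma bddMeas_inv_hawkinsY (h : IsHawkinsSieve μ α) (m : ℕ) :
    BddMeas (sieveSigma α m) fun ω => (hawkinsY (α ω) m)⁻¹ := by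
  refine ⟨(h.bddMeas_hawkinsY m).1.inv, 2 ^ m, fun ω => ?_⟩
  have hA := h.mem_ge_two ω
  rw [abs_of_pos (inv_pos.2 (hawkinsY_pos hA m))]
  refine (inv_anti₀ (by positivity) (one_half_pow_le_hawkinsY hA m)).trans_eq ?_
  simp

/-- Defining property of the conditional probabilities, tested against a bounded function. -/
lemma integral_mul_memInd (h : IsHawkinsSieve μ α) {n : ℕ} (hn : 2 ≤ n) {G : Ω → ℝ}
    (hG : BddMeas (sieveSigma α n) G) :
    ∫ ω, G ω * memInd (α ω) n ∂μ = ∫ ω, G ω * hawkinsY (α ω) n ∂μ := by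
  have := h.isProb
  have hle := h.sieveSigma_le n
  have hX : BddMeas mΩ fun ω => memInd (α ω) n :=
    (h.bddMeas_memInd (Nat.lt_succ_self n)).mono (h.sieveSigma_le _)
  have hind : (Set.indicator {ω | n ∈ α ω} fun _ => (1 : ℝ)) = fun ω => memInd (α ω) n := by
    ext ω
    simp [Set.indicator, memInd]
  have h1 := h.condExp_mem n hn
  rw [hind] at h1
  have h2 := condExp_mul_of_stronglyMeasurable_left (μ := μ) (m := sieveSigma α n)
    (f := G) (g := fun ω => memInd (α ω) n) hG.1.stronglyMeasurable
    ((hG.mono hle).mul hX).integrable hX.integrable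
  have h3 := integral_condExp (μ := μ) (f := G * fun ω => memInd (α ω) n) hle
  calc ∫ ω, G ω * memInd (α ω) n ∂μ = ∫ ω, (μ[G * fun ω => memInd (α ω) n|sieveSigma α n]) ω ∂μ :=
        h3.symm
    _ = _ := by
        refine integral_congr_ae ?_
        filter_upwards [h1, h2] with ω e1 e2
        rw [e2, Pi.mul_apply, e1]

/-- The martingale transform of the centred sieve indicators, shifted by `κ`. -/
noncomputable def transform (α : Ω → Set ℕ) (κ : ℕ) (G : ℕ → Ω → ℝ) (N : ℕ) (ω : Ω) : ℝ :=
  ∑ m ∈ range N, G m ω * (memInd (α ω) (m + κ) - hawkinsY (α ω) (m + κ))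

lemma bddMeas_transform (h : IsHawkinsSieve μ α) {κ : ℕ} {G : ℕ → Ω → ℝ}
    (hG : ∀ m, BddMeas (sieveSigma α (m + κ)) (G m)) (N : ℕ) :
    BddMeas (sieveSigma α (N + κ)) (transform α κ G N) := by
  refine BddMeas.sum _ fun m hm => ?_
  have hm' : m + κ < N + κ := by have := Finset.mem_range.1 hm; omega
  have hle := sieveSigma_mono α hm'.le
  exact ((hG m).mono hle).mul ((h.bddMeas_memInd hm').sub ((h.bddMeas_hawkinsY _).mono hle))

lemma integral_transform (h : IsHawkinsSieve μ α) {κ : ℕ} (hκ : 2 ≤ κ) {G : ℕ → Ω → ℝ}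
    (hG : ∀ m, BddMeas (sieveSigma α (m + κ)) (G m)) (N : ℕ) :
    ∫ ω, transform α κ G N ω ∂μ = 0 := by
  have := h.isProb
  have hX : ∀ n, BddMeas mΩ fun ω => memInd (α ω) n := fun n =>
    (h.bddMeas_memInd (Nat.lt_succ_self n)).mono (h.sieveSigma_le _)
  have hY : ∀ n, BddMeas mΩ fun ω => hawkinsY (α ω) n := fun n =>
    (h.bddMeas_hawkinsY n).mono (h.sieveSigma_le _)
  have hG' : ∀ m, BddMeas mΩ (G m) := fun m => (hG m).mono (h.sieveSigma_le _)
  unfold transform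
  rw [integral_finsetSum _ fun m _ => ((hG' m).mul ((hX _).sub (hY _))).integrable]
  refine Finset.sum_eq_zero fun m _ => ?_
  simp_rw [mul_sub]
  rw [integral_sub ((hG' m).mul (hX _)).integrable ((hG' m).mul (hY _)).integrable,
    h.integral_mul_memInd (by omega) (hG m), sub_self]

lemma integral_transform_sq_le (h : IsHawkinsSieve μ α) {κ : ℕ} (hκ : 2 ≤ κ) {G : ℕ → Ω → ℝ}
    (hG : ∀ m, BddMeas (sieveSigma α (m + κ)) (G m)) (N : ℕ) :
    ∫ ω, transform α κ G N ω ^ 2 ∂μ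
      ≤ ∑ m ∈ range N, ∫ ω, G m ω ^ 2 * hawkinsY (α ω) (m + κ) ∂μ := by
  have := h.isProb
  induction N with
  | zero => simp [transform]
  | succ N ih =>
    have hle := h.sieveSigma_le (N + κ)
    have hX : BddMeas mΩ fun ω => memInd (α ω) (N + κ) :=
      (h.bddMeas_memInd (Nat.lt_succ_self _)).mono (h.sieveSigma_le _)
    have hY := h.bddMeas_hawkinsY (N + κ)
    have hS := h.bddMeas_transform hG N
    have hP : BddMeas (sieveSigma α (N + κ)) fun ω => 2 * transform α κ G N ω * G N ω
        + G N ω ^ 2 * (1 - 2 * hawkinsY (α ω) (N + κ)) :=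
      (((BddMeas.const 2).mul hS).mul (hG N)).add
        (((hG N).pow 2).mul ((BddMeas.const 1).sub ((BddMeas.const 2).mul hY)))
    have hQ : BddMeas (sieveSigma α (N + κ)) fun ω => transform α κ G N ω ^ 2
        - 2 * transform α κ G N ω * G N ω * hawkinsY (α ω) (N + κ)
        + G N ω ^ 2 * hawkinsY (α ω) (N + κ) ^ 2 :=
      ((hS.pow 2).sub ((((BddMeas.const 2).mul hS).mul (hG N)).mul hY)).add
        (((hG N).pow 2).mul (hY.pow 2))
    have hsq : ∀ ω, transform α κ G (N + 1) ω ^ 2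
        = (2 * transform α κ G N ω * G N ω
          + G N ω ^ 2 * (1 - 2 * hawkinsY (α ω) (N + κ))) * memInd (α ω) (N + κ)
          + (transform α κ G N ω ^ 2
            - 2 * transform α κ G N ω * G N ω * hawkinsY (α ω) (N + κ)
            + G N ω ^ 2 * hawkinsY (α ω) (N + κ) ^ 2) := by
      intro ω
      have hs : transform α κ G (N + 1) ω = transform α κ G N ω
          + G N ω * (memInd (α ω) (N + κ) - hawkinsY (α ω) (N + κ)) :=
        Finset.sum_range_succ _ _
      rw [hs]
      linear_combination (G N ω ^ 2) * memInd_mul_self (α ω) (N + κ)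
    simp_rw [hsq]
    rw [integral_add ((hP.mono hle).mul hX).integrable (hQ.mono hle).integrable,
      h.integral_mul_memInd (by omega) hP,
      ← integral_add (hP.mul hY |>.mono hle).integrable (hQ.mono hle).integrable,
      Finset.sum_range_succ]
    refine le_trans ?_ (add_le_add_left ih _)
    rw [← integral_add (hS.pow 2 |>.mono hle).integrable
      (((hG N).pow 2).mul hY |>.mono hle).integrable]
    refine integral_mono ((hP.mul hY).add hQ |>.mono hle).integrable
      ((hS.pow 2).add (((hG N).pow 2).mul hY) |>.mono hle).integrable fun ω => ?_
    have : 0 ≤ G N ω ^ 2 * hawkinsY (α ω) (N + κ) ^ 2 := by positivity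
    simp only
    nlinarith

end IsHawkinsSieve

section Asymptotics

lemma sum_harmonic_div_sq_le (N : ℕ) :
    ∑ m ∈ range N, (1 + ∑ j ∈ range m, 1 / ((j : ℝ) + 1)) / ((m : ℝ) + 1) ^ 2
      ≤ 4 - 2 * (2 + ∑ j ∈ range N, 1 / ((j : ℝ) + 1)) / (N + 1) := by
  induction N with
  | zero => norm_num
  | succ N ih =>
    rw [Finset.sum_range_succ, Finset.sum_range_succ]
    have hH : 0 ≤ ∑ j ∈ range N, 1 / ((j : ℝ) + 1) := Finset.sum_nonneg fun _ _ => by positivity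
    set H := ∑ j ∈ range N, 1 / ((j : ℝ) + 1)
    have hN : (0 : ℝ) ≤ N := Nat.cast_nonneg N
    have key : 2 * (2 + H) / ((N : ℝ) + 1) - 2 * (2 + (H + 1 / ((N : ℝ) + 1))) / ((N : ℝ) + 1 + 1)
        - (1 + H) / ((N : ℝ) + 1) ^ 2 = (1 + H) * N / (((N : ℝ) + 1) ^ 2 * (N + 1 + 1)) := by
      field_simp
      ring
    have : 0 ≤ (1 + H) * N / (((N : ℝ) + 1) ^ 2 * (N + 1 + 1)) := by positivity
    push_cast
    linarith

lemma abs_one_add_harmonic_two_pow_sub_le (N : ℕ) :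
    |1 + ∑ j ∈ range (2 ^ N), 1 / ((j : ℝ) + 1) - N * Real.log 2| ≤ 2 := by
  have hH : ((harmonic (2 ^ N) : ℚ) : ℝ) = ∑ j ∈ range (2 ^ N), 1 / ((j : ℝ) + 1) := by
    simp [harmonic]
  have h1 := log_add_one_le_harmonic (2 ^ N)
  have h2 := harmonic_le_one_add_log (2 ^ N)
  have h3 : Real.log ((2 ^ N : ℕ) : ℝ) = N * Real.log 2 := by push_cast; rw [Real.log_pow]
  have h4 : Real.log ((2 ^ N : ℕ) : ℝ) ≤ Real.log ((2 ^ N + 1 : ℕ) : ℝ) := by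
    apply Real.log_le_log
    · positivity
    · push_cast; linarith
  rw [← hH, abs_le]
  constructor <;> linarith

/-- A monotone sequence which grows like the logarithm along powers of two grows like the
logarithm. -/
lemma tendsto_div_log_of_monotone {z : ℕ → ℝ} (hz : Monotone z)
    (h : Tendsto (fun N : ℕ => (z (2 ^ N + 2) - N * Real.log 2) / (N + 1)) atTop (nhds 0)) :
    Tendsto (fun m : ℕ => z m / Real.log m) atTop (nhds 1) := by
  set ε : ℕ → ℝ := fun N => |(z (2 ^ N + 2) - N * Real.log 2) / (N + 1)| with hε
  have hε0 : Tendsto ε atTop (nhds 0) := by simpa using h.abs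
  have hN : Tendsto (fun m : ℕ => Nat.log 2 (m - 2)) atTop atTop := by
    refine tendsto_atTop.2 fun b => ?_
    filter_upwards [eventually_ge_atTop (2 ^ b + 2)] with m hm
    exact Nat.le_log_of_pow_le (by norm_num) (by omega)
  have hlog : Tendsto (fun m : ℕ => Real.log m) atTop atTop :=
    Real.tendsto_log_atTop.comp tendsto_natCast_atTop_atTop
  have hbound : Tendsto (fun m : ℕ => 4 * (ε (Nat.log 2 (m - 2)) + ε (Nat.log 2 (m - 2) + 1))
      + 4 / Real.log m) atTop (nhds 0) := by
    have h1 := hε0.comp hN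
    have h2 := (hε0.comp (tendsto_add_atTop_nat 1)).comp hN
    have h3 : Tendsto (fun m : ℕ => 4 / Real.log m) atTop (nhds 0) := hlog.const_div_atTop 4
    simpa using ((h1.add h2).const_mul 4).add h3
  rw [tendsto_iff_norm_sub_tendsto_zero]
  refine squeeze_zero' (Eventually.of_forall fun _ => norm_nonneg _) ?_ hbound
  filter_upwards [eventually_ge_atTop 3, hlog.eventually_ge_atTop 1] with m hm hm1
  obtain ⟨p, rfl⟩ : ∃ p, m = p + 2 := ⟨m - 2, by omega⟩
  have hp : 1 ≤ p := by omega
  simp only [Nat.add_sub_cancel]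
  set N := Nat.log 2 p with hNdef
  set L := Real.log ((p + 2 : ℕ) : ℝ) with hL
  have hlo : 2 ^ N ≤ p := Nat.pow_log_le_self 2 (by omega)
  have hhi : p < 2 ^ (N + 1) := Nat.lt_pow_succ_log_self (by norm_num) p
  have hz1 : z (2 ^ N + 2) ≤ z (p + 2) := hz (by omega)
  have hz2 : z (p + 2) ≤ z (2 ^ (N + 1) + 2) := hz (by omega)
  have hp0 : (0 : ℝ) < p := by exact_mod_cast hp
  have hp1 : (1 : ℝ) ≤ p := by exact_mod_cast hp
  have hlog1 : N * Real.log 2 ≤ Real.log p := by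
    rw [← Real.log_pow]
    exact Real.log_le_log (by positivity) (by exact_mod_cast hlo)
  have hlog2 : Real.log p ≤ (N + 1) * Real.log 2 := by
    have := Real.log_le_log hp0 (show (p : ℝ) ≤ 2 ^ (N + 1) by exact_mod_cast hhi.le)
    rw [Real.log_pow] at this
    exact_mod_cast this
  have hlog3 : Real.log p ≤ L := Real.log_le_log hp0 (by push_cast; linarith)
  have hlog4 : L ≤ Real.log p + 2 := by
    have h3 : L ≤ Real.log (3 * p) :=
      Real.log_le_log (by positivity) (by push_cast; linarith)
    rw [Real.log_mul (by norm_num) hp0.ne'] at h3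
    have := Real.log_le_sub_one_of_pos (show (0 : ℝ) < 3 by norm_num)
    linarith
  have hl2 := Real.log_two_gt_d9
  have hl2' := Real.log_two_lt_d9
  have e1 : |z (2 ^ N + 2) - N * Real.log 2| = ε N * (N + 1) := by
    rw [hε]
    simp only
    rw [abs_div, abs_of_pos (show (0 : ℝ) < N + 1 by positivity)]
    field_simp
  have e2 : |z (2 ^ (N + 1) + 2) - (N + 1) * Real.log 2| = ε (N + 1) * (N + 2) := by
    rw [hε]
    simp only
    push_cast
    rw [abs_div, abs_of_pos (show (0 : ℝ) < N + 1 + 1 by positivity)]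
    field_simp
    ring
  have hN0 : (0 : ℝ) ≤ N := Nat.cast_nonneg N
  have hNL : (N : ℝ) + 2 ≤ 4 * L := by nlinarith
  have p1 : 0 ≤ ε N := abs_nonneg _
  have p2 : 0 ≤ ε (N + 1) := abs_nonneg _
  have f1 := abs_le.1 e1.le
  have f2 := abs_le.1 e2.le
  have q1 : ε N * (N + 1) ≤ ε N * (4 * L) := mul_le_mul_of_nonneg_left (by linarith) p1
  have q2 : ε (N + 1) * (N + 2) ≤ ε (N + 1) * (4 * L) := mul_le_mul_of_nonneg_left hNL p2
  have q3 : 0 ≤ ε N * (4 * L) := by positivity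
  have q4 : 0 ≤ ε (N + 1) * (4 * L) := by positivity
  have hL0 : 0 < L := by linarith
  have main : |z (p + 2) - L| ≤ (ε N + ε (N + 1)) * (4 * L) + 4 := by
    rw [abs_le]
    constructor <;> linarith [f1.1, f2.2]
  have : z (p + 2) / L - 1 = (z (p + 2) - L) / L := by field_simp
  rw [Real.norm_eq_abs, this, abs_div, abs_of_pos hL0, div_le_iff₀ hL0]
  refine main.trans_eq ?_
  field_simp

lemma isLittleO_log_pow_rpow (l : ℕ) {s : ℝ} (hs : 0 < s) :
    (fun m : ℕ => Real.log ((m : ℝ) + 1) ^ l) =o[atTop] fun m : ℕ => ((m : ℝ) + 1) ^ s := by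
  have h1 := isLittleO_log_rpow_rpow_atTop (l : ℝ) hs
  have h2 : Tendsto (fun m : ℕ => (m : ℝ) + 1) atTop atTop :=
    tendsto_atTop_add_const_right _ _ tendsto_natCast_atTop_atTop
  simpa [Function.comp_def] using h1.comp_tendsto h2

lemma isLittleO_rpow_div_log_pow (l : ℕ) {s : ℝ} (hs : s < 1) :
    (fun m : ℕ => ((m : ℝ) + 1) ^ s) =o[atTop]
      fun m : ℕ => ((m : ℝ) + 1) / Real.log ((m : ℝ) + 1) ^ l := by
  have h1 := (isLittleO_log_pow_rpow l (sub_pos.2 hs)).inv_rev (by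
    filter_upwards [eventually_ge_atTop 1] with m hm h0
    have : 0 < Real.log ((m : ℝ) + 1) := Real.log_pos (by
      have : (1 : ℝ) ≤ m := by exact_mod_cast hm
      linarith)
    exact absurd h0 (by positivity))
  refine ((isBigO_refl (fun m : ℕ => (m : ℝ) + 1) atTop).mul_isLittleO h1).congr
    (fun m => ?_) fun m => ?_
  · have hm : (0 : ℝ) < (m : ℝ) + 1 := by positivity
    rw [← Real.rpow_neg hm.le]
    nth_rw 1 [← Real.rpow_one ((m : ℝ) + 1)]
    rw [← Real.rpow_add hm]
    ring_nf
  · rw [div_eq_mul_inv]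

lemma isLittleO_inv_inv_log_pow (l : ℕ) :
    (fun m : ℕ => 1 / ((m : ℝ) + 1)) =o[atTop]
      fun m : ℕ => 1 / Real.log ((m : ℝ) + 1) ^ l := by
  refine ((isBigO_refl (fun m : ℕ => ((m : ℝ) + 1)⁻¹) atTop).mul_isLittleO
    (isLittleO_rpow_div_log_pow l zero_lt_one)).congr (fun m => ?_) fun m => ?_
  · simp
  · have hm : (m : ℝ) + 1 ≠ 0 := by positivity
    field_simp

lemma tendsto_mul_log_pow_increment (l : ℕ) :
    Tendsto (fun m : ℕ => ((((m : ℝ) + 1) + 1) / Real.log (((m : ℝ) + 1) + 1) ^ l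
      - ((m : ℝ) + 1) / Real.log ((m : ℝ) + 1) ^ l) * Real.log ((m : ℝ) + 1) ^ l)
      atTop (nhds 1) := by
  have hcast : Tendsto (fun m : ℕ => (m : ℝ) + 1 + 1) atTop atTop :=
    tendsto_atTop_add_const_right _ _
      (tendsto_atTop_add_const_right _ _ tendsto_natCast_atTop_atTop)
  have h0 : Tendsto (fun m : ℕ => 2 * (l / Real.log ((m : ℝ) + 1 + 1))) atTop (nhds 0) := by
    have := (Real.tendsto_log_atTop.comp hcast).const_div_atTop (l : ℝ)
    simpa using this.const_mul 2
  rw [tendsto_iff_norm_sub_tendsto_zero]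
  refine squeeze_zero' (Eventually.of_forall fun _ => norm_nonneg _) ?_ h0
  filter_upwards [eventually_ge_atTop 1] with m hm
  have hm1 : (1 : ℝ) ≤ m := by exact_mod_cast hm
  set u : ℝ := (m : ℝ) + 1 with hu
  have hu0 : 0 < u := by positivity
  have hl1 : 0 < Real.log u := Real.log_pos (by linarith)
  have hl2 : Real.log u ≤ Real.log (u + 1) := Real.log_le_log hu0 (by linarith)
  have hl3 : 0 < Real.log (u + 1) := by linarith
  set t := Real.log u / Real.log (u + 1) with ht
  have ht0 : 0 ≤ t := by positivity
  have ht1 : t ≤ 1 := (div_le_one hl3).2 hl2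
  have hdiff : u * (Real.log (u + 1) - Real.log u) ≤ 1 := by
    rw [← Real.log_div (by positivity) hu0.ne']
    have := Real.log_le_sub_one_of_pos (show 0 < (u + 1) / u by positivity)
    calc u * Real.log ((u + 1) / u) ≤ u * ((u + 1) / u - 1) :=
          mul_le_mul_of_nonneg_left this hu0.le
      _ = 1 := by field_simp; ring
  have hut : u * (1 - t) ≤ 1 / Real.log (u + 1) := by
    rw [le_div_iff₀ hl3, ht]
    calc u * (1 - Real.log u / Real.log (u + 1)) * Real.log (u + 1)
        = u * (Real.log (u + 1) - Real.log u) := by field_simp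
      _ ≤ 1 := hdiff
  have hbern : 1 + (l : ℝ) * (t - 1) ≤ t ^ l := by
    have := one_add_mul_le_pow (show -2 ≤ t - 1 by linarith) l
    simpa using this
  have htl : t ^ l ≤ 1 := pow_le_one₀ ht0 ht1
  have hmain : u * (1 - t ^ l) ≤ l / Real.log (u + 1) := by
    calc u * (1 - t ^ l) ≤ u * (l * (1 - t)) := mul_le_mul_of_nonneg_left (by linarith) hu0.le
      _ = l * (u * (1 - t)) := by ring
      _ ≤ l * (1 / Real.log (u + 1)) := mul_le_mul_of_nonneg_left hut (Nat.cast_nonneg l)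
      _ = _ := by ring
  have hexp : ((u + 1) / Real.log (u + 1) ^ l - u / Real.log u ^ l) * Real.log u ^ l - 1
      = -((u + 1) * (1 - t ^ l)) := by
    rw [ht, div_pow]
    field_simp
    ring
  have hnn : 0 ≤ 1 - t ^ l := by linarith
  rw [hexp, norm_neg, Real.norm_of_nonneg (by positivity)]
  nlinarith

lemma isEquivalent_log_pow_increment (l : ℕ) :
    (fun m : ℕ => (((m : ℝ) + 1) + 1) / Real.log (((m : ℝ) + 1) + 1) ^ l
      - ((m : ℝ) + 1) / Real.log ((m : ℝ) + 1) ^ l) ~[atTop]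
      fun m : ℕ => 1 / Real.log ((m : ℝ) + 1) ^ l := by
  refine isEquivalent_of_tendsto_one ?_
  refine (tendsto_mul_log_pow_increment l).congr fun m => ?_
  simp

lemma tendsto_sum_atTop_of_isEquivalent {l : ℕ} {a : ℕ → ℝ} (ha : ∀ m, 0 ≤ a m)
    (h : a ~[atTop] fun m : ℕ => 1 / Real.log ((m : ℝ) + 1) ^ l) :
    Tendsto (fun x => ∑ m ∈ range x, a m) atTop atTop := by
  rw [← not_summable_iff_tendsto_nat_atTop_of_nonneg ha]
  intro hs
  have h1 : (fun m : ℕ => 1 / ((m : ℝ) + 1)) =O[atTop] a :=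
    ((isLittleO_inv_inv_log_pow l).trans_isBigO h.isBigO_symm).isBigO
  have h2 : Summable fun m : ℕ => 1 / ((m : ℝ) + 1) := summable_of_isBigO_nat hs h1
  have h3 : Summable fun m : ℕ => 1 / (m : ℝ) := by
    rw [← summable_nat_add_iff 1]
    exact_mod_cast h2
  exact Real.not_summable_one_div_natCast h3

lemma isEquivalent_sum_of_isEquivalent {l : ℕ} (hl : l ≠ 0) {a : ℕ → ℝ} (ha : ∀ m, 0 ≤ a m)
    (h : a ~[atTop] fun m : ℕ => 1 / Real.log ((m : ℝ) + 1) ^ l) :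
    (fun x : ℕ => ∑ m ∈ range x, a m) ~[atTop]
      fun x : ℕ => ((x : ℝ) + 1) / Real.log ((x : ℝ) + 1) ^ l := by
  have h1 := ((isEquivalent_log_pow_increment l).trans h.symm).isLittleO.sum_range ha
    (tendsto_sum_atTop_of_isEquivalent ha h)
  refine IsEquivalent.symm (IsLittleO.congr_left h1 fun x => ?_)
  simp only [Pi.sub_apply, Finset.sum_sub_distrib]
  have := Finset.sum_range_sub (fun m : ℕ => ((m : ℝ) + 1) / Real.log ((m : ℝ) + 1) ^ l) x
  push_cast at this
  simp [← Finset.sum_sub_distrib, this, hl]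

/-- If the main terms are equivalent to `1 / log ^ l` and the fluctuations have sums of smaller
order, then the sums of the perturbed sequence have the expected asymptotics. -/
lemma isEquivalent_sum_add_add {l : ℕ} (hl : l ≠ 0) {a d e : ℕ → ℝ} (ha : ∀ m, 0 ≤ a m)
    (h : a ~[atTop] fun m : ℕ => 1 / Real.log ((m : ℝ) + 1) ^ l)
    (hd : (fun x : ℕ => ∑ m ∈ range x, d m) =o[atTop]
      fun x : ℕ => ((x : ℝ) + 1) / Real.log ((x : ℝ) + 1) ^ l)
    (he : e =O[atTop] fun m : ℕ => 1 / ((m : ℝ) + 1)) :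
    (fun x : ℕ => ∑ m ∈ range x, (a m + d m + e m)) ~[atTop]
      fun x : ℕ => ((x : ℝ) + 1) / Real.log ((x : ℝ) + 1) ^ l := by
  have h1 := isEquivalent_sum_of_isEquivalent hl ha h
  have h2 : e =o[atTop] a :=
    he.trans_isLittleO ((isLittleO_inv_inv_log_pow l).trans_isBigO h.isBigO_symm)
  have h3 := (h2.sum_range ha (tendsto_sum_atTop_of_isEquivalent ha h)).trans_isBigO h1.isBigO
  simp only [Finset.sum_add_distrib]
  exact (h1.add_isLittleO hd).add_isLittleO h3

lemma abs_sub_le_of_abs_succ_sub_le {S : ℕ → ℝ} (hS : ∀ n, |S (n + 1) - S n| ≤ 1) (n d : ℕ) :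
    |S (n + d) - S n| ≤ d := by
  induction d with
  | zero => simp
  | succ d ih =>
    have h1 := hS (n + d)
    have h2 : S (n + (d + 1)) - S n = (S (n + d + 1) - S (n + d)) + (S (n + d) - S n) := by
      rw [← add_assoc]; ring
    rw [h2]
    refine (abs_add_le _ _).trans ?_
    push_cast
    linarith

/-- A sequence with bounded increments which is small along the squares is small. -/
lemma isLittleO_of_tendsto_sq {S : ℕ → ℝ} (hS : ∀ n, |S (n + 1) - S n| ≤ 1)
    (h : Tendsto (fun N : ℕ => S (N ^ 2) * (N : ℝ) ^ (-(7 / 4) : ℝ)) atTop (nhds 0)) (l : ℕ) :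
    S =o[atTop] fun x : ℕ => ((x : ℝ) + 1) / Real.log ((x : ℝ) + 1) ^ l := by
  have hsqrt : Tendsto Nat.sqrt atTop atTop := by
    refine tendsto_atTop.2 fun b => ?_
    filter_upwards [eventually_ge_atTop (b * b)] with x hx
    exact Nat.le_sqrt.2 hx
  have hbig : S =O[atTop] fun x : ℕ => ((x : ℝ) + 1) ^ (7 / 8 : ℝ) := by
    refine IsBigO.of_bound 3 ?_
    have h1 := (tendsto_zero_iff_abs_tendsto_zero _).1 h
    filter_upwards [hsqrt.eventually (h1.eventually_le_const zero_lt_one),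
      eventually_ge_atTop 1] with x hx hx1
    have hN1 : 1 ≤ Nat.sqrt x := Nat.le_sqrt.2 (by omega)
    have hlo := Nat.sqrt_le x
    have hhi := Nat.sqrt_le_add x
    set N := Nat.sqrt x
    obtain ⟨d, hd⟩ : ∃ d, x = N ^ 2 + d := ⟨x - N ^ 2, by rw [pow_two]; omega⟩
    have hd2 : d ≤ 2 * N := by rw [pow_two] at hd; omega
    have hNr : (1 : ℝ) ≤ N := by exact_mod_cast hN1
    have hN0 : (0 : ℝ) < N := by linarith
    have hSN : |S (N ^ 2)| ≤ (N : ℝ) ^ (7 / 4 : ℝ) := by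
      simp only [Function.comp_apply] at hx
      rw [abs_mul, Real.rpow_neg hN0.le,
        abs_of_pos (by positivity : (0 : ℝ) < ((N : ℝ) ^ (7 / 4 : ℝ))⁻¹),
        ← div_eq_mul_inv, div_le_one (by positivity)] at hx
      exact hx
    have hinc := abs_sub_le_of_abs_succ_sub_le hS (N ^ 2) d
    rw [← hd] at hinc
    have hNle : (N : ℝ) ≤ (N : ℝ) ^ (7 / 4 : ℝ) := by
      nth_rw 1 [← Real.rpow_one (N : ℝ)]
      exact Real.rpow_le_rpow_of_exponent_le hNr (by norm_num)
    have hdr : (d : ℝ) ≤ 2 * N := by exact_mod_cast hd2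
    have hNx : (N : ℝ) ^ (7 / 4 : ℝ) ≤ ((x : ℝ) + 1) ^ (7 / 8 : ℝ) := by
      have : (N : ℝ) ^ (7 / 4 : ℝ) = ((N : ℝ) ^ (2 : ℕ)) ^ (7 / 8 : ℝ) := by
        rw [← Real.rpow_natCast, ← Real.rpow_mul hN0.le]
        norm_num
      rw [this]
      refine Real.rpow_le_rpow (by positivity) ?_ (by norm_num)
      have : N ^ 2 ≤ x := by rw [pow_two]; exact hlo
      have : ((N : ℝ)) ^ 2 ≤ x := by exact_mod_cast this
      linarith
    rw [Real.norm_eq_abs, Real.norm_of_nonneg (by positivity)]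
    have : |S x| ≤ |S x - S (N ^ 2)| + |S (N ^ 2)| := by
      have h2 := abs_add_le (S x - S (N ^ 2)) (S (N ^ 2))
      rwa [sub_add_cancel] at h2
    linarith
  exact hbig.trans_isLittleO (isLittleO_rpow_div_log_pow l (by norm_num))

end Asymptotics

namespace IsHawkinsSieve

variable {Ω : Type*} {mΩ : MeasurableSpace Ω} {μ : Measure Ω} {α : Ω → Set ℕ}

/-- The weights of the martingale part of the reciprocal sieve product. -/
noncomputable def invWeight (α : Ω → Set ℕ) (m : ℕ) (ω : Ω) : ℝ :=
  (hawkinsY (α ω) (m + 2))⁻¹ / (m + 1)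

lemma bddMeas_invWeight (h : IsHawkinsSieve μ α) (m : ℕ) :
    BddMeas (sieveSigma α (m + 2)) (invWeight α m) := by
  unfold invWeight
  simp_rw [div_eq_mul_inv]
  exact (h.bddMeas_inv_hawkinsY _).mul (BddMeas.const _)

lemma inv_hawkinsY_eq_add_transform (h : IsHawkinsSieve μ α) (m : ℕ) (ω : Ω) :
    (hawkinsY (α ω) (m + 2))⁻¹ = 1 + ∑ j ∈ range m, 1 / ((j : ℝ) + 1)
      + transform α 2 (invWeight α) m ω :=
  inv_hawkinsY_eq (h.mem_ge_two ω) m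

lemma integral_inv_hawkinsY (h : IsHawkinsSieve μ α) (m : ℕ) :
    ∫ ω, (hawkinsY (α ω) (m + 2))⁻¹ ∂μ = 1 + ∑ j ∈ range m, 1 / ((j : ℝ) + 1) := by
  have := h.isProb
  simp_rw [h.inv_hawkinsY_eq_add_transform]
  rw [integral_add (integrable_const _)
    ((h.bddMeas_transform h.bddMeas_invWeight m).mono (h.sieveSigma_le _)).integrable,
    h.integral_transform le_rfl h.bddMeas_invWeight]
  simp

lemma integral_transform_invWeight_sq_le (h : IsHawkinsSieve μ α) (N : ℕ) :
    ∫ ω, transform α 2 (invWeight α) N ω ^ 2 ∂μ ≤ 4 := by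
  refine (h.integral_transform_sq_le le_rfl h.bddMeas_invWeight N).trans ?_
  have heq : ∀ m : ℕ, ∫ ω, invWeight α m ω ^ 2 * hawkinsY (α ω) (m + 2) ∂μ
      = (1 + ∑ j ∈ range m, 1 / ((j : ℝ) + 1)) / ((m : ℝ) + 1) ^ 2 := by
    intro m
    rw [← h.integral_inv_hawkinsY, ← integral_div]
    congr 1
    ext ω
    have := (hawkinsY_pos (h.mem_ge_two ω) (m + 2)).ne'
    unfold invWeight
    field_simp
  simp_rw [heq]
  refine (sum_harmonic_div_sq_le N).trans ?_
  have hH : 0 ≤ ∑ j ∈ range N, 1 / ((j : ℝ) + 1) := Finset.sum_nonneg fun _ _ => by positivity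
  have : 0 ≤ 2 * (2 + ∑ j ∈ range N, 1 / ((j : ℝ) + 1)) / ((N : ℝ) + 1) := by positivity
  linarith

/-- Almost surely, the reciprocal of the sieve product is asymptotic to the logarithm. -/
lemma ae_tendsto_inv_hawkinsY_div_log (h : IsHawkinsSieve μ α) :
    ∀ᵐ ω ∂μ, Tendsto (fun m : ℕ => (hawkinsY (α ω) m)⁻¹ / Real.log m) atTop (nhds 1) := by
  have := h.isProb
  have hT : ∀ N, BddMeas mΩ (transform α 2 (invWeight α) N) := fun N =>
    (h.bddMeas_transform h.bddMeas_invWeight N).mono (h.sieveSigma_le _)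
  have hf : ∀ N : ℕ, BddMeas mΩ fun ω =>
      transform α 2 (invWeight α) (2 ^ N) ω * (1 / ((N : ℝ) + 1)) := fun N =>
    (hT _).mul (BddMeas.const _)
  have hae := ae_tendsto_zero_of_summable_integral_sq (μ := μ)
    (fun N => (hf N).1.aemeasurable) (fun N => ((hf N).pow 2).integrable) (by
      refine Summable.of_nonneg_of_le (fun N => integral_nonneg fun ω => sq_nonneg _)
        (f := fun N : ℕ => 4 * (1 / ((N : ℝ) + 1) ^ 2)) (fun N => ?_) ?_
      · simp_rw [mul_pow]
        rw [integral_mul_const, one_div_pow]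
        exact mul_le_mul_of_nonneg_right (h.integral_transform_invWeight_sq_le _) (by positivity)
      · refine Summable.mul_left 4 ?_
        have := (summable_nat_add_iff 1).2 (Real.summable_one_div_nat_pow.2 one_lt_two)
        exact_mod_cast this)
  filter_upwards [hae] with ω hω
  have hA := h.mem_ge_two ω
  refine tendsto_div_log_of_monotone
    (fun m n hmn => inv_anti₀ (hawkinsY_pos hA n) (hawkinsY_antitone hA hmn)) ?_
  have h1 : Tendsto (fun N : ℕ => (1 + ∑ j ∈ range (2 ^ N), 1 / ((j : ℝ) + 1)
      - N * Real.log 2) / ((N : ℝ) + 1)) atTop (nhds 0) := by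
    have h2 : Tendsto (fun N : ℕ => 2 / ((N : ℝ) + 1)) atTop (nhds 0) :=
      (tendsto_atTop_add_const_right _ _ tendsto_natCast_atTop_atTop).const_div_atTop 2
    refine squeeze_zero_norm (fun N => ?_) h2
    rw [Real.norm_eq_abs, abs_div, abs_of_pos (show (0 : ℝ) < N + 1 by positivity)]
    exact div_le_div_of_nonneg_right (abs_one_add_harmonic_two_pow_sub_le N) (by positivity)
  have h3 := h1.add hω
  rw [add_zero] at h3
  refine h3.congr fun N => ?_
  rw [h.inv_hawkinsY_eq_add_transform]
  ring

lemma isEquivalent_hawkinsY_pow {A : Set ℕ}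
    (hA : Tendsto (fun m : ℕ => (hawkinsY A m)⁻¹ / Real.log m) atTop (nhds 1)) (l : ℕ) :
    (fun m => hawkinsY A (m + 1) ^ l) ~[atTop]
      fun m : ℕ => 1 / Real.log ((m : ℝ) + 1) ^ l := by
  refine isEquivalent_of_tendsto_one ?_
  have h1 := ((hA.inv₀ one_ne_zero).comp (tendsto_add_atTop_nat 1)).pow l
  rw [inv_one, one_pow] at h1
  refine h1.congr fun m => ?_
  simp [mul_pow, mul_comm]

/-- Sums of unit-bounded martingale differences are almost surely of small order. -/
lemma ae_isLittleO_transform (h : IsHawkinsSieve μ α) {κ : ℕ} (hκ : 2 ≤ κ) {G : ℕ → Ω → ℝ}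
    (hG : ∀ m, BddMeas (sieveSigma α (m + κ)) (G m)) (hG1 : ∀ m ω, |G m ω| ≤ 1) (l : ℕ) :
    ∀ᵐ ω ∂μ, (fun x => transform α κ G x ω) =o[atTop]
      fun x : ℕ => ((x : ℝ) + 1) / Real.log ((x : ℝ) + 1) ^ l := by
  have := h.isProb
  have hT : ∀ N, BddMeas mΩ (transform α κ G N) := fun N =>
    (h.bddMeas_transform hG N).mono (h.sieveSigma_le _)
  have hf : ∀ N : ℕ, BddMeas mΩ fun ω =>
      transform α κ G (N ^ 2) ω * (N : ℝ) ^ (-(7 / 4) : ℝ) := fun N =>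
    (hT _).mul (BddMeas.const _)
  have hvar : ∀ N : ℕ, ∫ ω, transform α κ G N ω ^ 2 ∂μ ≤ N := by
    intro N
    refine (h.integral_transform_sq_le hκ hG N).trans ?_
    have hle : ∀ m ∈ range N, ∫ ω, G m ω ^ 2 * hawkinsY (α ω) (m + κ) ∂μ ≤ 1 := by
      intro m _
      have hb := (((hG m).pow 2).mul (h.bddMeas_hawkinsY (m + κ))).mono (h.sieveSigma_le _)
      refine (integral_mono hb.integrable (integrable_const (1 : ℝ)) fun ω => ?_).trans_eq
        (by simp)
      have hA := h.mem_ge_two ω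
      exact mul_le_one₀ ((sq_le_one_iff_abs_le_one _).2 (hG1 m ω)) (hawkinsY_pos hA _).le
        (hawkinsY_le_one hA _)
    simpa using Finset.sum_le_sum hle
  have hae := ae_tendsto_zero_of_summable_integral_sq (μ := μ)
    (fun N => (hf N).1.aemeasurable) (fun N => ((hf N).pow 2).integrable) (by
      refine Summable.of_nonneg_of_le (fun N => integral_nonneg fun ω => sq_nonneg _)
        (f := fun N : ℕ => (N : ℝ) ^ (-(3 / 2) : ℝ)) (fun N => ?_)
        (Real.summable_nat_rpow.2 (by norm_num))
      simp_rw [mul_pow]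
      rw [integral_mul_const]
      refine (mul_le_mul_of_nonneg_right (hvar _) (by positivity)).trans_eq ?_
      rcases Nat.eq_zero_or_pos N with rfl | hN
      · simp
      · have hN0 : (0 : ℝ) < N := by exact_mod_cast hN
        push_cast
        rw [← Real.rpow_natCast, ← Real.rpow_natCast, ← Real.rpow_mul hN0.le,
          ← Real.rpow_add hN0]
        norm_num)
  filter_upwards [hae] with ω hω
  refine isLittleO_of_tendsto_sq (fun n => ?_) hω l
  have hA := h.mem_ge_two ω
  have hs : transform α κ G (n + 1) ω - transform α κ G n ω
      = G n ω * (memInd (α ω) (n + κ) - hawkinsY (α ω) (n + κ)) := by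
    unfold transform
    rw [Finset.sum_range_succ]
    ring
  rw [hs, abs_mul]
  refine mul_le_one₀ (hG1 n ω) (abs_nonneg _) ?_
  have h1 := memInd_nonneg (α ω) (n + κ)
  have h2 := memInd_le_one (α ω) (n + κ)
  have h3 := hawkinsY_pos hA (n + κ)
  have h4 := hawkinsY_le_one hA (n + κ)
  rw [abs_le]
  constructor <;> linarith

end IsHawkinsSieve

lemma prod_range_eq_pow_add_sum (f : ℕ → ℝ) (y : ℝ) (l : ℕ) :
    ∏ i ∈ range l, f i
      = y ^ l + ∑ i ∈ range l, (∏ j ∈ range i, f j) * y ^ (l - 1 - i) * (f i - y) := by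
  induction l with
  | zero => simp
  | succ l ih =>
    rw [Finset.sum_range_succ, Finset.prod_range_succ]
    have hs : ∑ i ∈ range l, (∏ j ∈ range i, f j) * y ^ (l + 1 - 1 - i) * (f i - y)
        = y * ∑ i ∈ range l, (∏ j ∈ range i, f j) * y ^ (l - 1 - i) * (f i - y) := by
      rw [Finset.mul_sum]
      refine Finset.sum_congr rfl fun i hi => ?_
      have := Finset.mem_range.1 hi
      rw [show l + 1 - 1 - i = (l - 1 - i) + 1 by omega, pow_succ]
      ring
    rw [hs]
    simp only [Nat.add_sub_cancel, Nat.sub_self, pow_zero, mul_one, pow_succ]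
    linear_combination y * ih

namespace IsHawkinsSieve

variable {Ω : Type*} {mΩ : MeasurableSpace Ω} {μ : Measure Ω} {α : Ω → Set ℕ}

/-- The weight of the `i`-th factor in the martingale decomposition of a tuple indicator. -/
noncomputable def tupleWeight (α : Ω → Set ℕ) (l : ℕ) (s : ℕ → ℕ) (i m : ℕ) (ω : Ω) : ℝ :=
  (∏ j ∈ range i, memInd (α ω) (m + s j)) * hawkinsY (α ω) (m + 1) ^ (l - 1 - i)

lemma bddMeas_tupleWeight (h : IsHawkinsSieve μ α) (l : ℕ) {s : ℕ → ℕ} {i : ℕ}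
    (hi : 2 ≤ s i) (hs : ∀ j < i, s j < s i) (m : ℕ) :
    BddMeas (sieveSigma α (m + s i)) (tupleWeight α l s i m) := by
  refine BddMeas.mul (BddMeas.prod _ fun j hj => ?_) (BddMeas.pow ?_ _)
  · have := hs j (Finset.mem_range.1 hj)
    exact h.bddMeas_memInd (by omega)
  · exact (h.bddMeas_hawkinsY (m + 1)).mono (sieveSigma_mono α (by omega))

lemma abs_tupleWeight_le_one (h : IsHawkinsSieve μ α) (l : ℕ) (s : ℕ → ℕ) (i m : ℕ) (ω : Ω) :
    |tupleWeight α l s i m ω| ≤ 1 := by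
  have hA := h.mem_ge_two ω
  have hY := hawkinsY_pos hA (m + 1)
  have hP : 0 ≤ ∏ j ∈ range i, memInd (α ω) (m + s j) :=
    Finset.prod_nonneg fun j _ => memInd_nonneg _ _
  unfold tupleWeight
  rw [abs_of_nonneg (by positivity)]
  exact mul_le_one₀ (Finset.prod_le_one (fun j _ => memInd_nonneg _ _)
    fun j _ => memInd_le_one _ _) (by positivity) (pow_le_one₀ hY.le (hawkinsY_le_one hA _))

/-- Almost surely, the number of shifted tuples contained in the sieve has the expected order. -/
lemma ae_isEquivalent_sum_prod_memInd (h : IsHawkinsSieve μ α) {l : ℕ} (hl : l ≠ 0)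
    {s : ℕ → ℕ} (hs2 : ∀ i < l, 2 ≤ s i) (hs : ∀ i < l, ∀ j < i, s j < s i) :
    ∀ᵐ ω ∂μ, (fun x => ∑ m ∈ range x, ∏ i ∈ range l, memInd (α ω) (m + s i)) ~[atTop]
      fun x : ℕ => ((x : ℝ) + 1) / Real.log ((x : ℝ) + 1) ^ l := by
  have hD : ∀ᵐ ω ∂μ, ∀ i ∈ range l, (fun x => transform α (s i) (tupleWeight α l s i) x ω)
      =o[atTop] fun x : ℕ => ((x : ℝ) + 1) / Real.log ((x : ℝ) + 1) ^ l := by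
    rw [eventually_all_finset]
    intro i hi
    have hi' := Finset.mem_range.1 hi
    exact h.ae_isLittleO_transform (hs2 i hi') (h.bddMeas_tupleWeight l (hs2 i hi') (hs i hi'))
      (h.abs_tupleWeight_le_one l s i) l
  filter_upwards [hD, h.ae_tendsto_inv_hawkinsY_div_log] with ω hω hy
  have hA := h.mem_ge_two ω
  set y := hawkinsY (α ω)
  have hdec : ∀ m, ∏ i ∈ range l, memInd (α ω) (m + s i) = y (m + 1) ^ l
      + ∑ i ∈ range l, tupleWeight α l s i m ω * (memInd (α ω) (m + s i) - y (m + s i))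
      + ∑ i ∈ range l, tupleWeight α l s i m ω * (y (m + s i) - y (m + 1)) := by
    intro m
    rw [prod_range_eq_pow_add_sum _ (y (m + 1)), add_assoc, ← Finset.sum_add_distrib]
    congr 1
    refine Finset.sum_congr rfl fun i _ => ?_
    unfold tupleWeight
    ring
  simp_rw [hdec]
  refine isEquivalent_sum_add_add hl (fun m => pow_nonneg (hawkinsY_pos hA _).le l)
    (isEquivalent_hawkinsY_pow hy l) ?_ ?_
  · have := IsLittleO.sum hω
    refine this.congr_left fun x => ?_
    unfold transform
    rw [Finset.sum_comm, Finset.sum_apply]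
  · refine IsBigO.fun_sum fun i hi => IsBigO.of_bound (s i) (Eventually.of_forall fun m => ?_)
    have h2 := hs2 i (Finset.mem_range.1 hi)
    obtain ⟨d, hd⟩ : ∃ d, s i = 1 + d := ⟨s i - 1, by omega⟩
    have hdiff := hawkinsY_sub_le hA (show 1 ≤ m + 1 by omega) d
    have hmono := hawkinsY_antitone hA (show m + 1 ≤ m + 1 + d by omega)
    rw [norm_mul, Real.norm_eq_abs, Real.norm_eq_abs, hd, ← add_assoc, abs_sub_comm,
      abs_of_nonneg (sub_nonneg.2 hmono), Real.norm_of_nonneg (by positivity)]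
    have hm : (0 : ℝ) < (m : ℝ) + 1 := by positivity
    calc |tupleWeight α l s i m ω| * (y (m + 1) - y (m + 1 + d))
        ≤ 1 * (d / ((m + 1 : ℕ) : ℝ)) :=
          mul_le_mul (h.abs_tupleWeight_le_one l s i m ω) hdiff (sub_nonneg.2 hmono) zero_le_one
      _ ≤ ((1 + d : ℕ) : ℝ) * (1 / ((m : ℝ) + 1)) := by
          push_cast
          rw [one_mul, div_eq_mul_one_div]
          exact mul_le_mul_of_nonneg_right (by linarith) (by positivity)

end IsHawkinsSieve

/-- The offsets of a tuple, including the trivial one, shifted by two. -/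
def tupleShift (k : ℕ → ℕ) (i : ℕ) : ℕ := if i = 0 then 2 else k i + 2

lemma two_le_tupleShift (k : ℕ → ℕ) (i : ℕ) : 2 ≤ tupleShift k i := by
  unfold tupleShift; split_ifs <;> omega

lemma tupleShift_lt {l : ℕ} {k : ℕ → ℕ} (hk1 : 0 < k 1)
    (hmono : ∀ j : ℕ, 1 ≤ j → j + 1 ≤ l - 1 → k j < k (j + 1)) :
    ∀ i < l, ∀ j < i, tupleShift k j < tupleShift k i := by
  have hsucc : ∀ i, i + 1 < l → tupleShift k i < tupleShift k (i + 1) := by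
    intro i hi
    unfold tupleShift
    rcases Nat.eq_zero_or_pos i with rfl | hi0
    · simpa using hk1
    · have := hmono i hi0 (by omega)
      rw [if_neg (by omega), if_neg (by omega)]
      omega
  intro i
  induction i with
  | zero => intro _ j hj; omega
  | succ i ih =>
    intro hi j hj
    rcases Nat.lt_succ_iff_lt_or_eq.1 hj with hj' | rfl
    · exact (ih (by omega) j hj').trans (hsucc i hi)
    · exact hsucc j hi

lemma prod_memInd_tupleShift (A : Set ℕ) {l : ℕ} (hl : l ≠ 0) (k : ℕ → ℕ) (m : ℕ) :
    ∏ i ∈ range l, memInd A (m + tupleShift k i)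
      = if m + 2 ∈ A ∧ ∀ j : ℕ, 1 ≤ j → j ≤ l - 1 → m + 2 + k j ∈ A then 1 else 0 := by
  have hiff : (m + 2 ∈ A ∧ ∀ j : ℕ, 1 ≤ j → j ≤ l - 1 → m + 2 + k j ∈ A)
      ↔ ∀ i ∈ range l, m + tupleShift k i ∈ A := by
    constructor
    · rintro ⟨h0, hj⟩ i hi
      have hi' := Finset.mem_range.1 hi
      unfold tupleShift
      split_ifs with hi0
      · exact h0
      · have := hj i (by omega) (by omega)
        rwa [show m + (k i + 2) = m + 2 + k i by ring]
    · intro hall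
      refine ⟨by simpa [tupleShift] using hall 0 (Finset.mem_range.2 (by omega)), ?_⟩
      intro j hj1 hj2
      have := hall j (Finset.mem_range.2 (by omega))
      rw [tupleShift, if_neg (by omega)] at this
      rwa [show m + 2 + k j = m + (k j + 2) by ring]
  rw [if_congr hiff rfl rfl]
  unfold memInd
  split_ifs with hall
  · exact Finset.prod_eq_one fun i hi => if_pos (hall i hi)
  · push Not at hall
    obtain ⟨i, hi, hi'⟩ := hall
    exact Finset.prod_eq_zero hi (if_neg hi')

lemma piTuple_succ_eq_sum {A : Set ℕ} (hA : ∀ n ∈ A, 2 ≤ n) {l : ℕ} (hl : l ≠ 0) (k : ℕ → ℕ)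
    (x : ℕ) : (piTuple A l k (x + 1) : ℝ)
      = ∑ m ∈ range x, ∏ i ∈ range l, memInd A (m + tupleShift k i) := by
  have h0 : 0 ∉ A := fun h => by have := hA 0 h; omega
  have h1 : 1 ∉ A := fun h => by have := hA 1 h; omega
  simp_rw [prod_memInd_tupleShift A hl]
  unfold piTuple
  rw [Finset.natCast_card_filter, Finset.sum_range_succ', Finset.sum_range_succ']
  simp [h0, h1]

theorem tuples_hawkins (l : ℕ) (hl : 2 ≤ l) (k : ℕ → ℕ) (hk1 : 0 < k 1)
    (hmono : ∀ j : ℕ, 1 ≤ j → j + 1 ≤ l - 1 → k j < k (j + 1))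
    {Ω : Type*} [MeasurableSpace Ω] (μ : Measure Ω) (α : Ω → Set ℕ)
    (h : IsHawkinsSieve μ α) :
    ∀ᵐ ω ∂μ, Tendsto
      (fun x : ℕ => (piTuple (α ω) l k x : ℝ) / ((x : ℝ) / (Real.log x) ^ l))
      atTop (nhds 1) := by
  have hl0 : l ≠ 0 := by omega
  filter_upwards [h.ae_isEquivalent_sum_prod_memInd hl0 (fun i _ => two_le_tupleShift k i)
    (tupleShift_lt hk1 hmono)] with ω hω
  rw [isEquivalent_iff_tendsto_one] at hω
  · rw [← tendsto_add_atTop_iff_nat 1]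
    refine hω.congr fun x => ?_
    rw [Pi.div_apply, piTuple_succ_eq_sum (h.mem_ge_two ω) hl0]
    push_cast
    rfl
  · filter_upwards [eventually_ge_atTop 1] with x hx
    have : (1 : ℝ) ≤ x := by exact_mod_cast hx
    have : 0 < Real.log ((x : ℝ) + 1) := Real.log_pos (by linarith)
    positivity
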